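/- arXiv:0911.5730 — 2 statements merged into one kernel-verified Lean document; each statement's English description precedes it below -/
import Mathlib

section
/- Let V be a finite-dimensional real inner product space, S : V → V a symmetric positive semidefinite linear operator, E : V → V a linear operator, W̃ ⊆ V a linear subspace, Π the orthogonal projection of V onto W̃, and a > 0 a real number. Let N = ker(ΠSΠ + a(I−Π)), Π̄ the orthogonal projection onto the orthogonal complement of N, X = Π(I−E)*S(I−E)Π, Y = Π̄(ΠSΠ + a(I−Π))Π̄ + a(I−Π̄), and J(w) = ⟨S(I−E)w, (I−E)w⟩ / ⟨Sw, w⟩. Let w ∈ W̃ satisfy Π̄w = w and ⟨Sw, w⟩ ≠ 0. Then J is stationary at w along W̃ — that is, for every v ∈ W̃ the derivative at t = 0 of t ↦ J(w + t·v) is zero — if and only if X w = J(w)·Y w. In other words, the stationary vectors w and stationary values ω of the Rayleigh quotient J restricted to W̃ satisfy the generalized eigenvalue problem X w = ω Y w. -/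
open scoped RealInnerProductSpace

section RayleighQuotient

variable {V : Type*} [NormedAddCommGroup V] [InnerProductSpace ℝ V]

/-- The quadratic form of a symmetric operator has derivative `2 ⟪S x, y⟫` at `x` along `y`. -/
lemma hasDerivAt_inner_self_add_smul {S : V →ₗ[ℝ] V} (hS : ∀ u v : V, ⟪S u, v⟫ = ⟪u, S v⟫)
    (x y : V) :
    HasDerivAt (fun t : ℝ => ⟪S (x + t • y), x + t • y⟫) (2 * ⟪S x, y⟫) 0 := by
  have expand : (fun t : ℝ => ⟪S (x + t • y), x + t • y⟫) =
      fun t : ℝ => ⟪S x, x⟫ + (2 * ⟪S x, y⟫) * t + ⟪S y, y⟫ * t ^ 2 := by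
    funext t
    have hyx : ⟪S y, x⟫ = ⟪S x, y⟫ := by rw [hS, real_inner_comm]
    simp only [map_add, map_smul, inner_add_left, inner_add_right, real_inner_smul_left,
      real_inner_smul_right, hyx]
    ring
  rw [expand]
  have h := (((hasDerivAt_id (0 : ℝ)).const_mul (2 * ⟪S x, y⟫)).const_add ⟪S x, x⟫).fun_add
    (((hasDerivAt_id (0 : ℝ)).fun_pow 2).const_mul ⟪S y, y⟫)
  exact h.congr_deriv (by simp)

/-- The derivative of the quotient `⟪S (D x), D x⟫ / ⟪S x, x⟫` at `w` along `v`. -/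
lemma deriv_rayleigh_add_smul {S : V →ₗ[ℝ] V} (hS : ∀ u v : V, ⟪S u, v⟫ = ⟪u, S v⟫)
    (D : V →ₗ[ℝ] V) {w : V} (hw : ⟪S w, w⟫ ≠ 0) (v : V) :
    deriv (fun t : ℝ => ⟪S (D (w + t • v)), D (w + t • v)⟫ / ⟪S (w + t • v), w + t • v⟫) 0 =
      2 / ⟪S w, w⟫ * (⟪S (D w), D v⟫ - ⟪S (D w), D w⟫ / ⟪S w, w⟫ * ⟪S w, v⟫) := by
  have hnum := hasDerivAt_inner_self_add_smul hS (D w) (D v)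
  simp only [← map_smul, ← map_add] at hnum
  have h := hnum.fun_div (hasDerivAt_inner_self_add_smul hS w v) (by simpa using hw)
  rw [h.deriv]
  simp only [zero_smul, add_zero]
  field_simp

variable {W : Submodule ℝ V} {P : V →ₗ[ℝ] V}

lemma apply_eq_self_of_mem (hP : ∀ v : V, P v ∈ W ∧ v - P v ∈ Wᗮ) {w : V} (hw : w ∈ W) :
    P w = w := by
  have h : w - P w = 0 :=
    inner_self_eq_zero.mp
      (Submodule.inner_right_of_mem_orthogonal (W.sub_mem hw (hP w).1) (hP w).2 : ⟪_, _⟫ = 0)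
  exact (sub_eq_zero.mp h).symm

lemma inner_apply_left_of_mem (hP : ∀ v : V, P v ∈ W ∧ v - P v ∈ Wᗮ) (u : V) {v : V}
    (hv : v ∈ W) : ⟪P u, v⟫ = ⟪u, v⟫ := by
  have h : ⟪u - P u, v⟫ = 0 := Submodule.inner_left_of_mem_orthogonal hv (hP u).2
  rw [inner_sub_left] at h
  linarith

lemma apply_eq_zero_iff_forall_inner (hP : ∀ v : V, P v ∈ W ∧ v - P v ∈ Wᗮ) (u : V) :
    P u = 0 ↔ ∀ v ∈ W, ⟪u, v⟫ = 0 := by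
  constructor
  · intro h v hv
    rw [← inner_apply_left_of_mem hP u hv, h, inner_zero_left]
  · intro h
    apply inner_self_eq_zero (𝕜 := ℝ).mp
    rw [inner_apply_left_of_mem hP u (hP u).1, h _ (hP u).1]

lemma inner_apply_left_eq_right (hP : ∀ v : V, P v ∈ W ∧ v - P v ∈ Wᗮ) (u v : V) :
    ⟪P u, v⟫ = ⟪u, P v⟫ := by
  rw [← inner_apply_left_of_mem hP u (hP v).1, real_inner_comm,
    ← inner_apply_left_of_mem hP v (hP u).1, real_inner_comm]

/-- A symmetric operator maps into the orthogonal complement of its kernel. -/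
lemma apply_mem_orthogonal_ker {M : V →ₗ[ℝ] V} (hM : ∀ u v : V, ⟪M u, v⟫ = ⟪u, M v⟫) (x : V) :
    M x ∈ (LinearMap.ker M)ᗮ := by
  rw [Submodule.mem_orthogonal]
  intro u hu
  rw [← hM, LinearMap.mem_ker.mp hu, inner_zero_left]

end RayleighQuotient

/-- Stationarity of the Rayleigh quotient `J(w) = ⟪S (I−E) w, (I−E) w⟫ / ⟪S w, w⟫`
along the subspace `W̃` at a point `w ∈ W̃` with `Π̄ w = w` and `⟪S w, w⟫ ≠ 0` is
equivalent to the generalized eigenvalue equation `X w = J(w) • Y w`, where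
`X = Π (I−E)* S (I−E) Π` and `Y = Π̄ (Π S Π + a (I−Π)) Π̄ + a (I−Π̄)`. -/
theorem rayleigh_stationary_iff_generalized_eigenvector
    {V : Type*} [NormedAddCommGroup V] [InnerProductSpace ℝ V] [FiniteDimensional ℝ V]
    (S : V →ₗ[ℝ] V)
    (hS_sym : ∀ u v : V, ⟪S u, v⟫ = ⟪u, S v⟫)
    (hS_psd : ∀ v : V, 0 ≤ ⟪S v, v⟫)
    (E : V →ₗ[ℝ] V)
    (W : Submodule ℝ V)
    (P : V →ₗ[ℝ] V)
    (hP : ∀ v : V, P v ∈ W ∧ v - P v ∈ Wᗮ)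
    (a : ℝ) (ha : 0 < a)
    (N : Submodule ℝ V)
    (hN : N = LinearMap.ker (P ∘ₗ S ∘ₗ P + a • (LinearMap.id - P)))
    (Pb : V →ₗ[ℝ] V)
    (hPb : ∀ v : V, Pb v ∈ Nᗮ ∧ v - Pb v ∈ Nᗮᗮ)
    (X : V →ₗ[ℝ] V)
    (hX : X = P ∘ₗ LinearMap.adjoint (LinearMap.id - E) ∘ₗ S ∘ₗ (LinearMap.id - E) ∘ₗ P)
    (Y : V →ₗ[ℝ] V)
    (hY : Y = Pb ∘ₗ (P ∘ₗ S ∘ₗ P + a • (LinearMap.id - P)) ∘ₗ Pb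
            + a • (LinearMap.id - Pb))
    (J : V → ℝ)
    (hJ : J = fun x : V =>
      ⟪S (((LinearMap.id : V →ₗ[ℝ] V) - E) x), ((LinearMap.id : V →ₗ[ℝ] V) - E) x⟫ / ⟪S x, x⟫)
    (w : V) (hwW : w ∈ W) (hwPb : Pb w = w) (hw : ⟪S w, w⟫ ≠ 0) :
    (∀ v ∈ W, deriv (fun t : ℝ => J (w + t • v)) 0 = 0) ↔ X w = J w • Y w := by
  subst hN hX hY hJ
  set D : V →ₗ[ℝ] V := LinearMap.id - E
  set M : V →ₗ[ℝ] V := P ∘ₗ S ∘ₗ P + a • (LinearMap.id - P) with hM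
  have hM_sym : ∀ u v : V, ⟪M u, v⟫ = ⟪u, M v⟫ := by
    intro u v
    simp only [hM, LinearMap.add_apply, LinearMap.comp_apply, LinearMap.smul_apply,
      LinearMap.sub_apply, LinearMap.id_apply, inner_add_left, inner_add_right,
      real_inner_smul_left, real_inner_smul_right, inner_sub_left, inner_sub_right,
      inner_apply_left_eq_right hP, hS_sym]
  have hPw : P w = w := apply_eq_self_of_mem hP hwW
  have hMw : M w = P (S w) := by simp [hM, hPw]
  have hYw : (Pb ∘ₗ M ∘ₗ Pb + a • (LinearMap.id - Pb) : V →ₗ[ℝ] V) w = P (S w) := by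
    have hPbM : Pb (M w) = M w := apply_eq_self_of_mem hPb (apply_mem_orthogonal_ker hM_sym w)
    simp [hwPb, hPbM, ← hMw]
  rw [hYw]
  simp only [LinearMap.comp_apply, hPw, deriv_rayleigh_add_smul hS_sym D hw]
  rw [← sub_eq_zero, ← map_smul, ← map_sub, apply_eq_zero_iff_forall_inner hP]
  refine forall₂_congr fun v _ => ?_
  rw [inner_sub_left, real_inner_smul_left, LinearMap.adjoint_inner_left, mul_eq_zero,
    or_iff_right (div_ne_zero two_ne_zero hw)]
end

section
/- Let V be a finite-dimensional real inner product space, S : V → V a symmetric positive semidefinite linear operator, E : V → V a linear operator, W̃ ⊆ V a linear subspace, Π the orthogonal projection of V onto W̃, and a > 0 a real number. Let N = ker(ΠSΠ + a(I−Π)), Π̄ the orthogonal projection onto the orthogonal complement of N, X = Π(I−E)*S(I−E)Π, and Y = Π̄(ΠSΠ + a(I−Π))Π̄ + a(I−Π̄). If w ∈ W̃ is nonzero, Π̄w = w, and X w = ω Y w for some real ω, then ⟨Sw, w⟩ > 0 and the Rayleigh quotient satisfies J(w) = ⟨S(I−E)w, (I−E)w⟩ / ⟨Sw, w⟩ = ω;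 that is, each generalized eigenvector lying in W̃ and orthogonal to N realizes its eigenvalue as the value of the Rayleigh quotient. -/
open scoped RealInnerProductSpace

/-- If the quadratic form of a positive semidefinite operator vanishes at `w`, then so does the
operator. -/
theorem LinearMap.apply_eq_zero_of_inner_apply_self_eq_zero
    {V : Type*} [NormedAddCommGroup V] [InnerProductSpace ℝ V] {S : V →ₗ[ℝ] V}
    (hS_sym : ∀ u v : V, ⟪S u, v⟫ = ⟪u, S v⟫) (hS_psd : ∀ v : V, 0 ≤ ⟪S v, v⟫)
    {w : V} (hw : ⟪S w, w⟫ = 0) : S w = 0 := by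
  have hquad (t : ℝ) :
      0 ≤ ⟪S (S w), S w⟫ * (t * t) + 2 * ⟪S w, S w⟫ * t + 0 := by
    have h := hS_psd (w + t • S w)
    simp only [map_add, map_smul, inner_add_left, inner_add_right, real_inner_smul_left,
      real_inner_smul_right, hw, hS_sym (S w) w] at h
    linarith
  have hdiscrim := discrim_le_zero hquad
  rw [discrim] at hdiscrim
  exact inner_self_eq_zero.mp (pow_eq_zero_iff two_ne_zero |>.mp
    (le_antisymm (by linarith) (sq_nonneg ⟪S w, S w⟫)))

/-- An orthogonal projection onto `W` does not change the inner product with a vector of `W`. -/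
theorem Submodule.inner_eq_of_sub_mem_orthogonal
    {V : Type*} [NormedAddCommGroup V] [InnerProductSpace ℝ V] {W : Submodule ℝ V}
    {x y w : V} (hxy : x - y ∈ Wᗮ) (hw : w ∈ W) : ⟪y, w⟫ = ⟪x, w⟫ := by
  have h := W.inner_left_of_mem_orthogonal hw hxy
  rw [inner_sub_left] at h
  linarith

/-- A vector `y ∈ W` with `x - y ∈ Wᗮ` equals `x` when `x ∈ W`. -/
theorem Submodule.eq_of_sub_mem_orthogonal
    {V : Type*} [NormedAddCommGroup V] [InnerProductSpace ℝ V] {W : Submodule ℝ V}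
    {x y : V} (hx : x ∈ W) (hy : y ∈ W) (hxy : x - y ∈ Wᗮ) : y = x :=
  (sub_eq_zero.mp (inner_self_eq_zero (𝕜 := ℝ).mp
    (W.inner_left_of_mem_orthogonal (W.sub_mem hx hy) hxy))).symm

/-- If `w ∈ W̃` is nonzero, `Π̄ w = w`, and `X w = ω • Y w` for some real `ω`, where
`X = Π (I−E)* S (I−E) Π` and `Y = Π̄ (Π S Π + a (I−Π)) Π̄ + a (I−Π̄)`, then
`⟪S w, w⟫ > 0` and the Rayleigh quotient `J(w) = ⟪S (I−E) w, (I−E) w⟫ / ⟪S w, w⟫`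
equals `ω`. -/
theorem generalized_eigenvector_realizes_rayleigh_quotient
    {V : Type*} [NormedAddCommGroup V] [InnerProductSpace ℝ V] [FiniteDimensional ℝ V]
    (S : V →ₗ[ℝ] V)
    (hS_sym : ∀ u v : V, ⟪S u, v⟫ = ⟪u, S v⟫)
    (hS_psd : ∀ v : V, 0 ≤ ⟪S v, v⟫)
    (E : V →ₗ[ℝ] V)
    (W : Submodule ℝ V)
    (P : V →ₗ[ℝ] V)
    (hP : ∀ v : V, P v ∈ W ∧ v - P v ∈ Wᗮ)
    (a : ℝ) (ha : 0 < a)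
    (N : Submodule ℝ V)
    (hN : N = LinearMap.ker (P ∘ₗ S ∘ₗ P + a • (LinearMap.id - P)))
    (Pb : V →ₗ[ℝ] V)
    (hPb : ∀ v : V, Pb v ∈ Nᗮ ∧ v - Pb v ∈ Nᗮᗮ)
    (X : V →ₗ[ℝ] V)
    (hX : X = P ∘ₗ LinearMap.adjoint (LinearMap.id - E) ∘ₗ S ∘ₗ (LinearMap.id - E) ∘ₗ P)
    (Y : V →ₗ[ℝ] V)
    (hY : Y = Pb ∘ₗ (P ∘ₗ S ∘ₗ P + a • (LinearMap.id - P)) ∘ₗ Pb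
            + a • (LinearMap.id - Pb))
    (w : V) (hw0 : w ≠ 0) (hwW : w ∈ W) (hwPb : Pb w = w)
    (ω : ℝ) (heig : X w = ω • Y w) :
    0 < ⟪S w, w⟫ ∧
      ⟪S (((LinearMap.id : V →ₗ[ℝ] V) - E) w), ((LinearMap.id : V →ₗ[ℝ] V) - E) w⟫ /
        ⟪S w, w⟫ = ω := by
  have hPw : P w = w := Submodule.eq_of_sub_mem_orthogonal hwW (hP w).1 (hP w).2
  have hwN : w ∈ Nᗮ := hwPb ▸ (hPb w).1
  have hpos : 0 < ⟪S w, w⟫ := by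
    refine (hS_psd w).lt_of_ne' fun h ↦ hw0 ?_
    have hSw := LinearMap.apply_eq_zero_of_inner_apply_self_eq_zero hS_sym hS_psd h
    have hw : w ∈ N := by simp [hN, hPw, hSw]
    exact inner_self_eq_zero.mp (N.inner_right_of_mem_orthogonal hw hwN)
  have hXw : ⟪X w, w⟫ =
      ⟪S (((LinearMap.id : V →ₗ[ℝ] V) - E) w), ((LinearMap.id : V →ₗ[ℝ] V) - E) w⟫ := by
    simp only [hX, LinearMap.comp_apply, hPw]
    rw [Submodule.inner_eq_of_sub_mem_orthogonal (hP _).2 hwW, LinearMap.adjoint_inner_left]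
  have hYw : ⟪Y w, w⟫ = ⟪S w, w⟫ := by
    have h : Y w = Pb (P (S w)) := by simp [hY, hwPb, hPw]
    rw [h, Submodule.inner_eq_of_sub_mem_orthogonal (hPb _).2 hwN,
      Submodule.inner_eq_of_sub_mem_orthogonal (hP _).2 hwW]
  refine ⟨hpos, ?_⟩
  rw [← hXw, heig, real_inner_smul_left, hYw, mul_div_cancel_right₀ _ hpos.ne']
end
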